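/- Let N be a positive integer, Q₁, …, Q_N n×n real positive definite matrices, τ₁, …, τ_N positive real numbers, and for each i ∈ {1, …, N} let ωᵢ : [-τᵢ, 0] → ℝⁿ be a function such that ωᵢ and s ↦ ωᵢ(s)ᵀQᵢ⁻¹ωᵢ(s) are integrable on [-τᵢ, 0]. Set xᵢ = ∫_{-τᵢ}^0 ωᵢ(s) ds and Q = ∑_{i=1}^N Qᵢ. Then (∑_{i=1}^N xᵢ)ᵀ Q⁻¹ (∑_{i=1}^N xᵢ) ≤ ∑_{i=1}^N τᵢ ∫_{-τᵢ}^0 ωᵢ(s)ᵀ Qᵢ⁻¹ ωᵢ(s) ds (the multiple Jensen inequality). -/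

import Mathlib

open Matrix MeasureTheory

/-- Young's inequality for the quadratic forms of a positive definite matrix and its inverse. -/
theorem Matrix.PosDef.two_mul_dotProduct_sub_le {ι : Type*} [Fintype ι] [DecidableEq ι]
    {A : Matrix ι ι ℝ} (hA : A.PosDef) (v w : ι → ℝ) :
    2 * (v ⬝ᵥ w) - v ⬝ᵥ (A *ᵥ v) ≤ w ⬝ᵥ (A⁻¹ *ᵥ w) := by
  have hdet : IsUnit A.det := (isUnit_iff_isUnit_det A).1 hA.isUnit
  have hinv : A⁻¹ *ᵥ (A *ᵥ v) = v := by
    rw [mulVec_mulVec, nonsing_inv_mul _ hdet, one_mulVec]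
  have hsymm : (A *ᵥ v) ⬝ᵥ (A⁻¹ *ᵥ w) = v ⬝ᵥ w := by
    have hT : A⁻¹ᵀ = A⁻¹ := by simpa [IsHermitian] using hA.inv.isHermitian
    rw [dotProduct_mulVec, ← mulVec_transpose, hT, hinv]
  have h := hA.inv.posSemidef.dotProduct_mulVec_nonneg (w - A *ᵥ v)
  rw [star_trivial, mulVec_sub, hinv, sub_dotProduct, dotProduct_sub, dotProduct_sub, hsymm,
    dotProduct_comm w v, dotProduct_comm (A *ᵥ v) v] at h
  linarith

/-- Jensen's inequality for the quadratic form of `A⁻¹`, in dual form: its left-hand side is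
maximal at `v = A⁻¹ *ᵥ ∫ f`. -/
theorem Matrix.PosDef.two_mul_dotProduct_setIntegral_sub_le {ι : Type*} [Fintype ι]
    [DecidableEq ι] {A : Matrix ι ι ℝ} (hA : A.PosDef) {t : ℝ} (ht : 0 < t) {f : ℝ → ι → ℝ}
    (hf : IntegrableOn f (Set.Icc (-t) 0))
    (hq : IntegrableOn (fun s => f s ⬝ᵥ (A⁻¹ *ᵥ f s)) (Set.Icc (-t) 0)) (v : ι → ℝ) :
    2 * (v ⬝ᵥ ∫ s in Set.Icc (-t) 0, f s) - v ⬝ᵥ (A *ᵥ v)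
      ≤ t * ∫ s in Set.Icc (-t) 0, f s ⬝ᵥ (A⁻¹ *ᵥ f s) := by
  let L : (ι → ℝ) →L[ℝ] ℝ := LinearMap.toContinuousLinearMap (dotProductBilin ℝ ℝ v)
  have hint : IntegrableOn (fun s => v ⬝ᵥ f s) (Set.Icc (-t) 0) := L.integrable_comp hf
  have hcomm : ∫ s in Set.Icc (-t) 0, v ⬝ᵥ f s = v ⬝ᵥ ∫ s in Set.Icc (-t) 0, f s :=
    L.integral_comp_comm hf
  have hconst : IntegrableOn (fun _ : ℝ => v ⬝ᵥ (A *ᵥ v)) (Set.Icc (-t) 0) :=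
    integrableOn_const (by simp)
  have hmono := integral_mono ((hint.const_mul (2 * t)).sub hconst) (hq.const_mul (t ^ 2))
    fun s => by
      have h := hA.two_mul_dotProduct_sub_le v (t • f s)
      simp only [mulVec_smul, dotProduct_smul, smul_dotProduct, smul_eq_mul] at h
      simp only [Pi.sub_apply]
      linarith
  rw [integral_sub' (hint.const_mul (2 * t)) hconst, integral_const_mul, integral_const_mul,
    hcomm, setIntegral_const] at hmono
  simp only [Real.volume_real_Icc, zero_sub, neg_neg, max_eq_left ht.le, smul_eq_mul] at hmono
  refine le_of_mul_le_mul_left ?_ ht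
  linarith

/-- The multiple Jensen inequality:
`(∑ xᵢ)ᵀ Q⁻¹ (∑ xᵢ) ≤ ∑ τᵢ ∫_{-τᵢ}^0 ωᵢᵀ Qᵢ⁻¹ ωᵢ`, where `xᵢ = ∫_{-τᵢ}^0 ωᵢ`
and `Q = ∑ Qᵢ`. -/
theorem multiple_jensen {n N : ℕ} (hN : 0 < N)
    (Q : Fin N → Matrix (Fin n) (Fin n) ℝ) (hQ : ∀ i, (Q i).PosDef)
    (τ : Fin N → ℝ) (hτ : ∀ i, 0 < τ i)
    (ω : Fin N → ℝ → (Fin n → ℝ))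
    (hω : ∀ i, IntegrableOn (ω i) (Set.Icc (-(τ i)) 0))
    (hq : ∀ i, IntegrableOn (fun s => ω i s ⬝ᵥ ((Q i)⁻¹ *ᵥ ω i s)) (Set.Icc (-(τ i)) 0))
    (x : Fin N → (Fin n → ℝ))
    (hx : ∀ i, x i = ∫ s in Set.Icc (-(τ i)) 0, ω i s) :
    (∑ i, x i) ⬝ᵥ ((∑ i, Q i)⁻¹ *ᵥ ∑ i, x i)
      ≤ ∑ i, τ i * ∫ s in Set.Icc (-(τ i)) 0, ω i s ⬝ᵥ ((Q i)⁻¹ *ᵥ ω i s) := by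
  have : Nonempty (Fin N) := ⟨⟨0, hN⟩⟩
  have hsum : (∑ i, Q i).PosDef := posDef_sum Finset.univ_nonempty fun i _ => hQ i
  have hdet : IsUnit (∑ i, Q i).det := (isUnit_iff_isUnit_det _).1 hsum.isUnit
  set v := (∑ i, Q i)⁻¹ *ᵥ ∑ i, x i with hv
  have hQv : (∑ i, Q i) *ᵥ v = ∑ i, x i := by
    rw [hv, mulVec_mulVec, mul_nonsing_inv _ hdet, one_mulVec]
  calc (∑ i, x i) ⬝ᵥ v
      = 2 * (v ⬝ᵥ ∑ i, x i) - v ⬝ᵥ ((∑ i, Q i) *ᵥ v) := by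
        rw [hQv, dotProduct_comm]
        ring
    _ = ∑ i, (2 * (v ⬝ᵥ x i) - v ⬝ᵥ (Q i *ᵥ v)) := by
        rw [Finset.sum_sub_distrib, ← Finset.mul_sum, ← dotProduct_sum, ← dotProduct_sum,
          ← sum_mulVec]
    _ ≤ _ := Finset.sum_le_sum fun i _ => by
        rw [hx i]
        exact (hQ i).two_mul_dotProduct_setIntegral_sub_le (hτ i) (hω i) (hq i) v
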